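/- arXiv:2508.05600 — 15 statements merged into one kernel-verified Lean document; each statement's English description precedes it below -/
import Mathlib

section
/- Let d be a positive integer, u a unit vector in EuclideanSpace ℝ (Fin d), η > 0, and x_p = η·u. Let C > 0, 0 < φ < 1, K > 0, ŝ ≥ 0, and let (x_1,y_1),…,(x_n,y_n) be labeled samples with x_i ∈ EuclideanSpace ℝ (Fin d) and y_i ∈ ℝ. Assume Σ_{i=1}^n |⟨x_i, u⟩| ≤ ŝ, and let T ∈ EuclideanSpace ℝ (Fin d) satisfy |⟨T, x_i⟩ − y_i| ≤ 2K for every i and ⟨T, x_p⟩ < 1 − φ. If η > (2Kŝ + √(4K²ŝ² + 4φ(1−φ)/C)) / (2φ), then the vector g = T + C·Σ_{i=1}^n (⟨T,x_i⟩ − y_i)·x_i + C·(⟨T,x_p⟩ − 1)·x_p satisfies ⟨g, x_p⟩ < 0; in particular g ≠ 0. -/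
open scoped RealInnerProductSpace BigOperators

/-- A real number beyond the larger root of `a * X ^ 2 - b * X - c` makes the quadratic positive. -/
lemma quadratic_pos_of_root_lt {a b c t : ℝ} (ha : 0 < a)
    (ht : (b + Real.sqrt (b ^ 2 + 4 * a * c)) / (2 * a) < t) : b * t + c < a * t ^ 2 := by
  rw [div_lt_iff₀ (by positivity)] at ht
  have hlt : b ^ 2 + 4 * a * c < (t * (2 * a) - b) ^ 2 :=
    Real.lt_sq_of_sqrt_lt (by linarith)
  have : 0 < a * (a * t ^ 2 - (b * t + c)) := by nlinarith
  linarith [pos_of_mul_pos_right this ha.le]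

/-- A linear combination with coefficients bounded by `B` has inner product with `v` at most `B`
times the sum of the absolute inner products. -/
lemma inner_sum_smul_le {ι E : Type*} [Fintype ι] [NormedAddCommGroup E] [InnerProductSpace ℝ E]
    (r : ι → ℝ) (x : ι → E) (v : E) {B : ℝ} (hr : ∀ i, |r i| ≤ B) :
    inner ℝ (∑ i, r i • x i) v ≤ B * ∑ i, |inner ℝ (x i) v| := by
  rw [sum_inner, Finset.mul_sum]
  refine Finset.sum_le_sum fun i _ => ?_
  rw [real_inner_smul_left]
  calc r i * inner ℝ (x i) v ≤ |r i| * |inner ℝ (x i) v| := by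
        rw [← abs_mul]; exact le_abs_self _
    _ ≤ B * |inner ℝ (x i) v| := mul_le_mul_of_nonneg_right (hr i) (abs_nonneg _)

/-- One-poison attack gradient condition for linear regression (deterministic core). -/
theorem stmt_0 (d n : ℕ) (hd : 0 < d)
    (u : EuclideanSpace ℝ (Fin d)) (hu : ‖u‖ = 1)
    (η : ℝ) (hη0 : 0 < η)
    (x_p : EuclideanSpace ℝ (Fin d)) (hxp : x_p = η • u)
    (C φ K shat : ℝ) (hC : 0 < C) (hφ0 : 0 < φ) (hφ1 : φ < 1) (hK : 0 < K) (hshat : 0 ≤ shat)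
    (x : Fin n → EuclideanSpace ℝ (Fin d)) (y : Fin n → ℝ)
    (hsum : ∑ i, |⟪x i, u⟫| ≤ shat)
    (T : EuclideanSpace ℝ (Fin d))
    (hT : ∀ i, |⟪T, x i⟫ - y i| ≤ 2 * K)
    (hTxp : ⟪T, x_p⟫ < 1 - φ)
    (hηbig : η > (2 * K * shat + Real.sqrt (4 * K ^ 2 * shat ^ 2 + 4 * φ * (1 - φ) / C)) / (2 * φ))
    (g : EuclideanSpace ℝ (Fin d))
    (hg : g = T + C • (∑ i, (⟪T, x i⟫ - y i) • x i) + (C * (⟪T, x_p⟫ - 1)) • x_p) :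
    ⟪g, x_p⟫ < 0 ∧ g ≠ 0 := by
  have hneg : ⟪g, x_p⟫ < 0 := by
    have hquad : 2 * K * shat * η + (1 - φ) / C < φ * η ^ 2 := by
      refine quadratic_pos_of_root_lt hφ0 ?_
      convert hηbig using 4
      ring
    have hquad' : C * (2 * K * shat * η) + (1 - φ) < C * (φ * η ^ 2) := by
      have := mul_lt_mul_of_pos_left hquad hC
      rwa [mul_add, mul_div_cancel₀ _ hC.ne'] at this
    have hxx : ⟪x_p, x_p⟫ = η ^ 2 := by
      rw [real_inner_self_eq_norm_sq, hxp, norm_smul, hu, mul_one, Real.norm_eq_abs, sq_abs]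
    have hres : ⟪∑ i, (⟪T, x i⟫ - y i) • x i, x_p⟫ ≤ 2 * K * shat * η := by
      have hle := (inner_sum_smul_le _ x u hT).trans
        (mul_le_mul_of_nonneg_left hsum (by positivity))
      rw [hxp, real_inner_smul_right, mul_comm]
      exact mul_le_mul_of_nonneg_right hle hη0.le
    have hgx : ⟪g, x_p⟫ = ⟪T, x_p⟫ * (1 + C * η ^ 2) - C * η ^ 2
        + C * ⟪∑ i, (⟪T, x i⟫ - y i) • x i, x_p⟫ := by
      rw [hg, inner_add_left, inner_add_left, real_inner_smul_left, real_inner_smul_left, hxx]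
      ring
    have hmargin := mul_lt_mul_of_pos_right hTxp (show 0 < 1 + C * η ^ 2 by positivity)
    have hCres := mul_le_mul_of_nonneg_left hres hC.le
    rw [hgx]
    linarith
  refine ⟨hneg, ?_⟩
  rintro rfl
  simp at hneg
end

section
/- Let d be a positive integer, u a unit vector in EuclideanSpace ℝ (Fin d), C > 0, 0 < φ < 1, η > √(φ(1−φ)) / (φ·√C), and x_p = η·u. Let (x_1,y_1),…,(x_n,y_n) be labeled samples with ⟨x_i, u⟩ = 0 for every i. Then for every T ∈ EuclideanSpace ℝ (Fin d) with ⟨T, x_p⟩ < 1 − φ, the vector g = T + C·Σ_{i=1}^n (⟨T,x_i⟩ − y_i)·x_i + C·(⟨T,x_p⟩ − 1)·x_p satisfies ⟨g, x_p⟩ < 0; in particular g ≠ 0. -/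
open scoped RealInnerProductSpace BigOperators

/-- One-poison regression attack, zero-projection special case: success with probability 1. -/
theorem stmt_2 (d n : ℕ) (hd : 0 < d)
    (u : EuclideanSpace ℝ (Fin d)) (hu : ‖u‖ = 1)
    (C φ η : ℝ) (hC : 0 < C) (hφ0 : 0 < φ) (hφ1 : φ < 1)
    (hη : η > Real.sqrt (φ * (1 - φ)) / (φ * Real.sqrt C))
    (x_p : EuclideanSpace ℝ (Fin d)) (hxp : x_p = η • u)
    (x : Fin n → EuclideanSpace ℝ (Fin d)) (y : Fin n → ℝ)
    (horth : ∀ i, ⟪x i, u⟫ = 0)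
    (T : EuclideanSpace ℝ (Fin d)) (hTxp : ⟪T, x_p⟫ < 1 - φ)
    (g : EuclideanSpace ℝ (Fin d))
    (hg : g = T + C • (∑ i, (⟪T, x i⟫ - y i) • x i) + (C * (⟪T, x_p⟫ - 1)) • x_p) :
    ⟪g, x_p⟫ < 0 ∧ g ≠ 0 := by
  have key : 1 - φ < φ * (C * η ^ 2) := by
    have hsC : 0 < Real.sqrt C := Real.sqrt_pos.mpr hC
    have h1 : Real.sqrt (φ * (1 - φ)) < η * (φ * Real.sqrt C) :=
      (div_lt_iff₀ (mul_pos hφ0 hsC)).mp hη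
    have h2 : φ * (1 - φ) < (η * (φ * Real.sqrt C)) ^ 2 :=
      Real.lt_sq_of_sqrt_lt h1
    have h3 : (η * (φ * Real.sqrt C)) ^ 2 = φ * (φ * (C * η ^ 2)) := by
      rw [mul_pow, mul_pow, Real.sq_sqrt hC.le]
      ring
    rw [h3] at h2
    exact lt_of_mul_lt_mul_left h2 hφ0.le
  have hsum : ⟪∑ i, (⟪T, x i⟫ - y i) • x i, x_p⟫ = 0 := by
    rw [sum_inner]
    refine Finset.sum_eq_zero fun i _ => ?_
    rw [hxp, real_inner_smul_left, real_inner_smul_right, horth i, mul_zero, mul_zero]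
  have hpp : ⟪x_p, x_p⟫ = η ^ 2 := by
    rw [real_inner_self_eq_norm_sq, hxp, norm_smul, hu, mul_one, Real.norm_eq_abs, sq_abs]
  have hinner : ⟪g, x_p⟫ = ⟪T, x_p⟫ + C * η ^ 2 * (⟪T, x_p⟫ - 1) := by
    rw [hg, inner_add_left, inner_add_left, real_inner_smul_left, real_inner_smul_left,
      hsum, hpp]
    ring
  have hneg : ⟪g, x_p⟫ < 0 := by
    rw [hinner]
    have hCη : 0 ≤ C * η ^ 2 := by positivity
    nlinarith [mul_nonneg hCη (sub_nonneg.mpr hTxp.le)]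
  refine ⟨hneg, ?_⟩
  intro h0
  rw [h0, inner_zero_left] at hneg
  exact lt_irrefl _ hneg
end

section
/- Let d be a positive integer, u a unit vector in EuclideanSpace ℝ (Fin d), C > 0, 0 < φ < 1, η > √(φ(1−φ)) / (φ·√C), and x_p = η·u. Let D_cl = ((x_1,y_1),…,(x_n,y_n)) be labeled samples with ⟨x_i, u⟩ = 0 for every i, and let D_poi be D_cl together with the poison sample (x_p, 1). Then the unique minimizer f_poi of the regularized squared error loss L_sq(D_poi, ·) over EuclideanSpace ℝ (Fin d) satisfies ⟨f_poi, x_p⟩ ≥ 1 − φ. -/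
open scoped RealInnerProductSpace BigOperators

/-- A real quadratic `t ↦ t * b + t ^ 2 * a` that is nonnegative everywhere has no linear term. -/
theorem eq_zero_of_forall_nonneg_linear_add_sq {a b : ℝ}
    (h : ∀ t : ℝ, 0 ≤ t * b + t ^ 2 * a) : b = 0 := by
  have hdiscrim : discrim a b 0 ≤ 0 :=
    discrim_le_zero fun t => by linarith [h t]
  rw [discrim, mul_zero, sub_zero] at hdiscrim
  exact sq_nonpos_iff b |>.mp hdiscrim

/-- Any minimizer of the poisoned regularized squared error loss predicts the
poison sample with value at least `1 - φ` (zero-projection special case). -/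
theorem stmt_3 (d n : ℕ) (hd : 0 < d)
    (u : EuclideanSpace ℝ (Fin d)) (hu : ‖u‖ = 1)
    (C φ η : ℝ) (hC : 0 < C) (hφ0 : 0 < φ) (hφ1 : φ < 1)
    (hη : η > Real.sqrt (φ * (1 - φ)) / (φ * Real.sqrt C))
    (x_p : EuclideanSpace ℝ (Fin d)) (hxp : x_p = η • u)
    (x : Fin n → EuclideanSpace ℝ (Fin d)) (y : Fin n → ℝ)
    (horth : ∀ i, ⟪x i, u⟫ = 0)
    (Lpoi : EuclideanSpace ℝ (Fin d) → ℝ)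
    (hLpoi : Lpoi = fun f => (1 / 2) * ‖f‖ ^ 2
      + C * ∑ i, (y i - ⟪f, x i⟫) ^ 2 + C * (1 - ⟪f, x_p⟫) ^ 2)
    (f_poi : EuclideanSpace ℝ (Fin d))
    (hmin : ∀ f, Lpoi f_poi ≤ Lpoi f) :
    ⟪f_poi, x_p⟫ ≥ 1 - φ := by
  subst hLpoi hxp
  have hvar : ∀ t : ℝ, 0 ≤ t * (⟪f_poi, u⟫ - 2 * C * η * (1 - η * ⟪f_poi, u⟫))
      + t ^ 2 * ((1 + 2 * (C * η ^ 2)) / 2) := by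
    intro t
    have h := hmin (f_poi + t • u)
    have hx : ∀ i, ⟪u, x i⟫ = 0 := fun i => by rw [real_inner_comm, horth i]
    have huu : ⟪u, u⟫ = 1 := by rw [real_inner_self_eq_norm_sq, hu, one_pow]
    simp only [norm_add_sq_real, inner_add_left, real_inner_smul_left, real_inner_smul_right,
      norm_smul, mul_pow, hu, hx, huu, mul_zero, add_zero, Real.norm_eq_abs, sq_abs] at h
    linarith
  have hgrad := eq_zero_of_forall_nonneg_linear_add_sq hvar
  have hsqrt : 0 ≤ √(φ * (1 - φ)) / (φ * √C) := by positivity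
  have hη2 : (√(φ * (1 - φ)) / (φ * √C)) ^ 2 < η ^ 2 := pow_lt_pow_left₀ hη hsqrt two_ne_zero
  rw [div_pow, mul_pow, Real.sq_sqrt (mul_nonneg hφ0.le (sub_nonneg.2 hφ1.le)),
    Real.sq_sqrt hC.le, div_lt_iff₀ (by positivity)] at hη2
  have hk : 1 - φ < C * η ^ 2 * φ := by
    refine lt_of_mul_lt_mul_left ?_ hφ0.le
    linarith
  rw [real_inner_smul_right]
  have hk0 : 0 ≤ C * η ^ 2 := by positivity
  have hstat : (1 + 2 * (C * η ^ 2)) * (η * ⟪f_poi, u⟫) = 2 * (C * η ^ 2) := by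
    linear_combination η * hgrad
  nlinarith
end

section
/- Let d be a positive integer and x_p ∈ EuclideanSpace ℝ (Fin d) with x_p ≠ 0. Let D_cl = ((x_1,y_1),…,(x_n,y_n)) be labeled samples with ⟨x_i, x_p⟩ = 0 for every i, and let D_poi be D_cl together with the extra sample (x_p, 1). Then for every f ∈ EuclideanSpace ℝ (Fin d), writing p = (⟨f,x_p⟩/‖x_p‖²)·x_p and r = f − p, the regularized squared error loss decomposes as L_sq(D_poi, f) = [(1/2)·‖r‖² + C·Σ_{i=1}^n (y_i − ⟨r,x_i⟩)²] + [(1/2)·‖p‖² + C·(1 − ⟨p,x_p⟩)²]. -/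
open scoped RealInnerProductSpace BigOperators

/-- Orthogonal decomposition of the poisoned regularized squared error loss
into a benign part (remainder) and a poison part (projection). -/
theorem stmt_5 (d n : ℕ) (hd : 0 < d)
    (x_p : EuclideanSpace ℝ (Fin d)) (hxp : x_p ≠ 0)
    (x : Fin n → EuclideanSpace ℝ (Fin d)) (y : Fin n → ℝ)
    (horth : ∀ i, ⟪x i, x_p⟫ = 0)
    (C : ℝ) (hC : 0 < C)
    (f : EuclideanSpace ℝ (Fin d))
    (p r : EuclideanSpace ℝ (Fin d))
    (hp : p = (⟪f, x_p⟫ / ‖x_p‖ ^ 2) • x_p) (hr : r = f - p) :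
    (1 / 2) * ‖f‖ ^ 2 + C * ∑ i, (y i - ⟪f, x i⟫) ^ 2 + C * (1 - ⟪f, x_p⟫) ^ 2
      = ((1 / 2) * ‖r‖ ^ 2 + C * ∑ i, (y i - ⟪r, x i⟫) ^ 2)
        + ((1 / 2) * ‖p‖ ^ 2 + C * (1 - ⟪p, x_p⟫) ^ 2) := by
  have hnorm : ‖x_p‖ ^ 2 ≠ 0 := pow_ne_zero 2 (norm_ne_zero_iff.mpr hxp)
  have hpx : ⟪p, x_p⟫ = ⟪f, x_p⟫ := by
    rw [hp, real_inner_smul_left, real_inner_self_eq_norm_sq, div_mul_cancel₀ _ hnorm]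
  have hrx : ∀ i, ⟪r, x i⟫ = ⟪f, x i⟫ := fun i => by
    rw [hr, inner_sub_left, hp, real_inner_smul_left, real_inner_comm (x i) x_p, horth, mul_zero, sub_zero]
  have hrp : ⟪r, p⟫ = 0 := by
    have h : ⟪r, x_p⟫ = 0 := by rw [hr, inner_sub_left, hpx, sub_self]
    rw [hp, real_inner_smul_right, h, mul_zero]
  have hf : ‖f‖ ^ 2 = ‖r‖ ^ 2 + ‖p‖ ^ 2 := by
    have hfrp : f = r + p := by rw [hr, sub_add_cancel]
    rw [hfrp, norm_add_sq_real, hrp]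
    ring
  simp only [hrx, hpx, hf]
  ring
end

section
/- Let d be a positive integer and x_p ∈ EuclideanSpace ℝ (Fin d) with x_p ≠ 0. Let D_cl = ((x_1,y_1),…,(x_n,y_n)) be labeled samples with ⟨x_i, x_p⟩ = 0 for every i, let C > 0, and let D_poi be D_cl together with the extra sample (x_p, 1). Let f_cl be the unique minimizer of the regularized squared error loss L_sq(D_cl, ·) and f_poi the unique minimizer of L_sq(D_poi, ·). Then for every x ∈ EuclideanSpace ℝ (Fin d) with ⟨x, x_p⟩ = 0, one has ⟨f_poi, x⟩ = ⟨f_cl, x⟩. -/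
open scoped RealInnerProductSpace BigOperators

/-- Functional equivalence for regression: when all benign samples are orthogonal
to the poison sample, the poisoned regressor agrees with the clean regressor on
every input orthogonal to the poison direction. -/
theorem stmt_7 (d n : ℕ) (hd : 0 < d)
    (x_p : EuclideanSpace ℝ (Fin d)) (hxp : x_p ≠ 0)
    (x : Fin n → EuclideanSpace ℝ (Fin d)) (y : Fin n → ℝ)
    (horth : ∀ i, ⟪x i, x_p⟫ = 0)
    (C : ℝ) (hC : 0 < C)
    (Lcl Lpoi : EuclideanSpace ℝ (Fin d) → ℝ)
    (hLcl : Lcl = fun f => (1 / 2) * ‖f‖ ^ 2 + C * ∑ i, (y i - ⟪f, x i⟫) ^ 2)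
    (hLpoi : Lpoi = fun f => (1 / 2) * ‖f‖ ^ 2 + C * ∑ i, (y i - ⟪f, x i⟫) ^ 2
      + C * (1 - ⟪f, x_p⟫) ^ 2)
    (f_cl f_poi : EuclideanSpace ℝ (Fin d))
    (hmincl : ∀ f, Lcl f_cl ≤ Lcl f)
    (hminpoi : ∀ f, Lpoi f_poi ≤ Lpoi f) :
    ∀ x' : EuclideanSpace ℝ (Fin d), ⟪x', x_p⟫ = 0 → ⟪f_poi, x'⟫ = ⟪f_cl, x'⟫ := by
  intro x' hx'
  subst hLcl hLpoi
  -- the component of `f_poi - f_cl` orthogonal to `x_p`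
  obtain ⟨a, w, hw, hwp⟩ : ∃ (a : ℝ) (w : EuclideanSpace ℝ (Fin d)),
      f_poi = f_cl + w + a • x_p ∧ ⟪w, x_p⟫ = 0 := by
    refine ⟨⟪f_poi - f_cl, x_p⟫ / ⟪x_p, x_p⟫,
      f_poi - f_cl - (⟪f_poi - f_cl, x_p⟫ / ⟪x_p, x_p⟫) • x_p, by abel, ?_⟩
    rw [inner_sub_left, real_inner_smul_left, div_mul_cancel₀ _ (inner_self_ne_zero.mpr hxp),
      sub_self]
  have hpx : ∀ i, ⟪x_p, x i⟫ = 0 := fun i => by rw [real_inner_comm, horth]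
  have hpx' : ⟪x_p, x'⟫ = 0 := by rw [real_inner_comm, hx']
  have hpw : ⟪x_p, w⟫ = 0 := by rw [real_inner_comm, hwp]
  -- compare each minimizer with its shift by half of `w` towards the other one
  have hcl := hmincl (f_cl + (1 / 2 : ℝ) • w)
  have hpoi := hminpoi (f_poi - (1 / 2 : ℝ) • w)
  have hsum : ∑ i, (y i - ⟪f_cl + (1 / 2 : ℝ) • w, x i⟫) ^ 2
      + ∑ i, (y i - ⟪f_poi - (1 / 2 : ℝ) • w, x i⟫) ^ 2
      ≤ ∑ i, (y i - ⟪f_cl, x i⟫) ^ 2 + ∑ i, (y i - ⟪f_poi, x i⟫) ^ 2 := by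
    rw [← Finset.sum_add_distrib, ← Finset.sum_add_distrib]
    refine Finset.sum_le_sum fun i _ => ?_
    simp only [hw, inner_add_left, inner_sub_left, real_inner_smul_left, hpx]
    nlinarith [sq_nonneg ⟪w, x i⟫]
  have hp : ⟪f_poi - (1 / 2 : ℝ) • w, x_p⟫ = ⟪f_poi, x_p⟫ := by
    rw [inner_sub_left, real_inner_smul_left, hwp, mul_zero, sub_zero]
  have hnorm : ‖f_cl + (1 / 2 : ℝ) • w‖ ^ 2 + ‖f_poi - (1 / 2 : ℝ) • w‖ ^ 2
      = ‖f_cl‖ ^ 2 + ‖f_poi‖ ^ 2 - ‖w‖ ^ 2 / 2 := by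
    have hinner : ⟪f_poi, w⟫ = ⟪f_cl, w⟫ + ‖w‖ ^ 2 := by
      rw [hw, inner_add_left, inner_add_left, real_inner_smul_left, hpw,
        real_inner_self_eq_norm_sq, mul_zero, add_zero]
    rw [norm_add_sq_real, norm_sub_sq_real, real_inner_smul_right, real_inner_smul_right,
      norm_smul, hinner]
    norm_num
    ring
  have hCsum := mul_le_mul_of_nonneg_left hsum hC.le
  have hw0 : w = 0 := by
    have hle : ‖w‖ ^ 2 ≤ 0 := by
      simp only [hp] at hcl hpoi
      linarith
    exact norm_eq_zero.mp (pow_eq_zero_iff two_ne_zero |>.mp (le_antisymm hle (sq_nonneg _)))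
  rw [hw, hw0, add_zero, inner_add_left, real_inner_smul_left, hpx', mul_zero, add_zero]
end

section
/- Let X be a measurable space, x_p ∈ X a point with measurable singleton {x_p}, μ_cl a probability measure on X, n ≥ 2 an integer, and μ_poi = (1 − 1/n)·μ_cl + (1/n)·δ_{x_p}, where δ_{x_p} is the Dirac measure at x_p. Let 0 < α ≤ 1, C' > 0, and let l : ℝ × ℝ → ℝ be nonnegative and satisfy l(a,b) ≤ l(a,c) + C'·|c − b|^α for all a,b,c ∈ ℝ. Let f̂, f*_poi, f*_cl : X → ℝ be measurable with x ↦ l(f̂(x), f*_poi(x)) integrable with respect to μ_poi, and suppose f*_poi(x) = f*_cl(x) for all x ≠ x_p and |f*_poi(x_p) − f*_cl(x_p)| ≤ 2/n. Then ∫ l(f̂(x), f*_cl(x)) dμ_cl(x) ≤ (1 − 1/n)⁻¹ · ∫ l(f̂(x), f*_poi(x)) dμ_poi(x) + C'·(2·μ_cl({x_p})/n)^α. -/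
open MeasureTheory

/-- Regression statistical-risk corollary: the risk on benign data is bounded
by the risk on poisoned data plus a term vanishing in `1/n`. -/
theorem stmt_8 {X : Type*} [MeasurableSpace X]
    (x_p : X) (hxp : MeasurableSet ({x_p} : Set X))
    (μcl : Measure X) [IsProbabilityMeasure μcl]
    (n : ℕ) (hn : 2 ≤ n)
    (μpoi : Measure X)
    (hμpoi : μpoi = ENNReal.ofReal (1 - 1 / (n : ℝ)) • μcl
      + ENNReal.ofReal (1 / (n : ℝ)) • Measure.dirac x_p)
    (α C' : ℝ) (hα0 : 0 < α) (hα1 : α ≤ 1) (hC' : 0 < C')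
    (l : ℝ → ℝ → ℝ) (hl0 : ∀ a b, 0 ≤ l a b)
    (hlip : ∀ a b c, l a b ≤ l a c + C' * |c - b| ^ α)
    (fhat fpoi fcl : X → ℝ)
    (hfhat : Measurable fhat) (hfpoi : Measurable fpoi) (hfcl : Measurable fcl)
    (hint : Integrable (fun x => l (fhat x) (fpoi x)) μpoi)
    (heq : ∀ x, x ≠ x_p → fpoi x = fcl x)
    (hdiff : |fpoi x_p - fcl x_p| ≤ 2 / (n : ℝ)) :
    ∫ x, l (fhat x) (fcl x) ∂μcl
      ≤ (1 - 1 / (n : ℝ))⁻¹ * ∫ x, l (fhat x) (fpoi x) ∂μpoi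
        + C' * (2 * (μcl {x_p}).toReal / (n : ℝ)) ^ α := by
  have hn' : (2 : ℝ) ≤ n := by exact_mod_cast hn
  have hn0 : (0 : ℝ) < n := by linarith
  have hc : 0 < 1 - 1 / (n : ℝ) := by
    rw [sub_pos, div_lt_one hn0]
    linarith
  set c : ℝ := 1 - 1 / (n : ℝ) with hcdef
  set p : ℝ := (μcl {x_p}).toReal with hp
  have hp0 : 0 ≤ p := ENNReal.toReal_nonneg
  have hp1 : p ≤ 1 := measureReal_le_one (μ := μcl)
  set K : ℝ := C' * (2 / (n : ℝ)) ^ α with hK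
  rw [hμpoi] at hint
  have hint_cl : Integrable (fun x => l (fhat x) (fpoi x)) μcl :=
    (integrable_smul_measure (by simpa using hc) ENNReal.ofReal_ne_top).1
      hint.left_of_add_measure
  have hind : Integrable (({x_p} : Set X).indicator fun _ => K) μcl :=
    (integrable_const K).indicator hxp
  have hpoint : ∀ x, l (fhat x) (fcl x)
      ≤ l (fhat x) (fpoi x) + ({x_p} : Set X).indicator (fun _ => K) x := by
    intro x
    have h := hlip (fhat x) (fcl x) (fpoi x)
    by_cases hx : x = x_p
    · subst hx
      have hpow : C' * |fpoi x - fcl x| ^ α ≤ K :=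
        mul_le_mul_of_nonneg_left
          (Real.rpow_le_rpow (abs_nonneg _) hdiff hα0.le) hC'.le
      simp only [Set.mem_singleton_iff, Set.indicator_of_mem]
      linarith
    · simp [hx, heq x hx]
  have hmono : ∫ x, l (fhat x) (fcl x) ∂μcl
      ≤ ∫ x, l (fhat x) (fpoi x) ∂μcl + p * K := by
    calc ∫ x, l (fhat x) (fcl x) ∂μcl
        ≤ ∫ x, (l (fhat x) (fpoi x) + ({x_p} : Set X).indicator (fun _ => K) x) ∂μcl :=
          integral_mono_of_nonneg (.of_forall fun x => hl0 _ _) (hint_cl.add hind)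
            (.of_forall hpoint)
      _ = _ := by
          rw [integral_add hint_cl hind, integral_indicator_const K hxp]
          rfl
  have hpoi : c * ∫ x, l (fhat x) (fpoi x) ∂μcl ≤ ∫ x, l (fhat x) (fpoi x) ∂μpoi := by
    rw [hμpoi, integral_add_measure hint.left_of_add_measure hint.right_of_add_measure,
      integral_smul_measure, ENNReal.toReal_ofReal hc.le, smul_eq_mul]
    exact le_add_of_nonneg_right (integral_nonneg fun x => hl0 _ _)
  have hpK : p * K ≤ C' * (2 * p / (n : ℝ)) ^ α := by
    have hpα : p ≤ p ^ α := Real.self_le_rpow_of_le_one hp0 hp1 hα1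
    rw [show 2 * p / (n : ℝ) = p * (2 / n) by ring, Real.mul_rpow hp0 (by positivity)]
    calc p * K ≤ p ^ α * K := mul_le_mul_of_nonneg_right hpα (by positivity)
      _ = _ := by rw [hK]; ring
  have hdiv : ∫ x, l (fhat x) (fpoi x) ∂μcl ≤ c⁻¹ * ∫ x, l (fhat x) (fpoi x) ∂μpoi :=
    (le_inv_mul_iff₀ hc).2 hpoi
  linarith
end

section
/- Let d be a positive integer, u a unit vector in EuclideanSpace ℝ (Fin d), η > 0, x_p = η·u, C > 0, and ŝ ≥ 0. Let (x_1,y_1),…,(x_n,y_n) be labeled samples with x_i ∈ EuclideanSpace ℝ (Fin d), y_i ∈ {−1,1}, and Σ_{i=1}^n |⟨x_i, u⟩| ≤ ŝ. Let T ∈ EuclideanSpace ℝ (Fin d) satisfy ⟨T, x_p⟩ < 1. If η > (ŝ + √(ŝ² + 4/C)) / 2, then the vector g = T − C·Σ_{i : y_i·⟨T,x_i⟩ < 1} y_i·x_i − C·x_p satisfies ⟨g, x_p⟩ < 0; in particular g ≠ 0. -/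
open scoped RealInnerProductSpace BigOperators

/-- A sub-sum of sign-weighted terms is bounded below by minus the sum of all absolute values. -/
theorem neg_sum_abs_le_sum_sign_mul {ι : Type*} [Fintype ι] (s : Finset ι) (a y : ι → ℝ)
    (hy : ∀ i, y i = -1 ∨ y i = 1) : -∑ i, |a i| ≤ ∑ i ∈ s, y i * a i := by
  calc -∑ i, |a i| ≤ -∑ i ∈ s, |a i| := neg_le_neg <|
        Finset.sum_le_sum_of_subset_of_nonneg s.subset_univ fun i _ _ => abs_nonneg (a i)
    _ = ∑ i ∈ s, -|a i| := (Finset.sum_neg_distrib _).symm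
    _ ≤ ∑ i ∈ s, y i * a i := Finset.sum_le_sum fun i _ => by
        rcases hy i with h | h <;> rw [h]
        · linarith [le_abs_self (a i)]
        · linarith [neg_abs_le (a i)]

/-- Beyond the larger root, the quadratic `C * t ^ 2 - C * s * t - 1` is positive. -/
theorem one_lt_of_quadratic_root_lt {C s t : ℝ} (hC : 0 < C)
    (ht : (s + Real.sqrt (s ^ 2 + 4 / C)) / 2 < t) : 1 < C * t ^ 2 - C * s * t := by
  have h : s ^ 2 + 4 / C < (2 * t - s) ^ 2 :=
    Real.lt_sq_of_sqrt_lt (by linarith)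
  have h' : C * (4 / C) < C * ((2 * t - s) ^ 2 - s ^ 2) := by
    gcongr
    linarith
  rw [mul_div_cancel₀ _ hC.ne'] at h'
  linarith

/-- One-poison attack gradient condition for linear classification
(hinge loss, deterministic core). -/
theorem stmt_9 (d n : ℕ) (hd : 0 < d)
    (u : EuclideanSpace ℝ (Fin d)) (hu : ‖u‖ = 1)
    (η : ℝ) (hη0 : 0 < η)
    (x_p : EuclideanSpace ℝ (Fin d)) (hxp : x_p = η • u)
    (C shat : ℝ) (hC : 0 < C) (hshat : 0 ≤ shat)
    (x : Fin n → EuclideanSpace ℝ (Fin d)) (y : Fin n → ℝ)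
    (hy : ∀ i, y i = -1 ∨ y i = 1)
    (hsum : ∑ i, |⟪x i, u⟫| ≤ shat)
    (T : EuclideanSpace ℝ (Fin d)) (hTxp : ⟪T, x_p⟫ < 1)
    (hη : η > (shat + Real.sqrt (shat ^ 2 + 4 / C)) / 2)
    (g : EuclideanSpace ℝ (Fin d))
    (hg : g = T - C • (∑ i ∈ Finset.univ.filter (fun i => y i * ⟪T, x i⟫ < 1),
      y i • x i) - C • x_p) :
    ⟪g, x_p⟫ < 0 ∧ g ≠ 0 := by
  have key : ⟪g, x_p⟫ < 0 := by
    set s := Finset.univ.filter fun i => y i * ⟪T, x i⟫ < 1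
    have hinner : ⟪g, x_p⟫ = ⟪T, x_p⟫ - C * η * (∑ i ∈ s, y i * ⟪x i, u⟫) - C * η ^ 2 := by
      rw [hg, hxp]
      simp only [inner_sub_left, real_inner_smul_left, real_inner_smul_right, sum_inner,
        real_inner_self_eq_norm_sq, hu]
      ring
    have hlower := neg_sum_abs_le_sum_sign_mul s (fun i => ⟪x i, u⟫) y hy
    have hquad := one_lt_of_quadratic_root_lt hC hη
    have hmul : C * η * -shat ≤ C * η * ∑ i ∈ s, y i * ⟪x i, u⟫ := by
      gcongr
      linarith
    linarith
  refine ⟨key, ?_⟩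
  rintro rfl
  simp at key
end

section
/- Let d be a positive integer, u a unit vector in EuclideanSpace ℝ (Fin d), C > 0, η > 1/√C, and x_p = η·u. Let (x_1,y_1),…,(x_n,y_n) be labeled samples with y_i ∈ {−1,1} and ⟨x_i, u⟩ = 0 for every i. Then for every T ∈ EuclideanSpace ℝ (Fin d) with ⟨T, x_p⟩ < 1, the vector g = T − C·Σ_{i : y_i·⟨T,x_i⟩ < 1} y_i·x_i − C·x_p satisfies ⟨g, x_p⟩ < 0; in particular g ≠ 0. -/
open scoped RealInnerProductSpace BigOperators

/-- One-poison classification attack, zero-projection special case: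
success with probability 1. -/
theorem stmt_11 (d n : ℕ) (hd : 0 < d)
    (u : EuclideanSpace ℝ (Fin d)) (hu : ‖u‖ = 1)
    (C η : ℝ) (hC : 0 < C) (hη : η > 1 / Real.sqrt C)
    (x_p : EuclideanSpace ℝ (Fin d)) (hxp : x_p = η • u)
    (x : Fin n → EuclideanSpace ℝ (Fin d)) (y : Fin n → ℝ)
    (hy : ∀ i, y i = -1 ∨ y i = 1)
    (horth : ∀ i, ⟪x i, u⟫ = 0)
    (T : EuclideanSpace ℝ (Fin d)) (hTxp : ⟪T, x_p⟫ < 1)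
    (g : EuclideanSpace ℝ (Fin d))
    (hg : g = T - C • (∑ i ∈ Finset.univ.filter (fun i => y i * ⟪T, x i⟫ < 1),
      y i • x i) - C • x_p) :
    ⟪g, x_p⟫ < 0 ∧ g ≠ 0 := by
  have hCη : 1 < C * η ^ 2 := by
    have hsqrt : 0 < √C := Real.sqrt_pos.mpr hC
    have h1 : 1 < η * √C := (div_lt_iff₀ hsqrt).mp hη
    calc 1 < (η * √C) ^ 2 := one_lt_pow₀ h1 two_ne_zero
      _ = C * η ^ 2 := by rw [mul_pow, Real.sq_sqrt hC.le, mul_comm]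
  have hsum : ⟪∑ i ∈ Finset.univ.filter (fun i => y i * ⟪T, x i⟫ < 1), y i • x i, x_p⟫ = 0 := by
    rw [sum_inner]
    refine Finset.sum_eq_zero fun i _ => ?_
    rw [hxp, real_inner_smul_left, real_inner_smul_right, horth i, mul_zero, mul_zero]
  have hnorm : ⟪x_p, x_p⟫ = η ^ 2 := by
    rw [real_inner_self_eq_norm_sq, hxp, norm_smul, hu, mul_one, Real.norm_eq_abs, sq_abs]
  have hneg : ⟪g, x_p⟫ < 0 := by
    rw [hg, inner_sub_left, inner_sub_left, real_inner_smul_left, real_inner_smul_left, hsum, hnorm]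
    linarith
  refine ⟨hneg, ?_⟩
  rintro rfl
  simp at hneg
end

section
/- Let d be a positive integer, u a unit vector in EuclideanSpace ℝ (Fin d), C > 0, η > 1/√C, and x_p = η·u. Let D_cl = ((x_1,y_1),…,(x_n,y_n)) be labeled samples with y_i ∈ {−1,1} and ⟨x_i, u⟩ = 0 for every i, and let D_poi be D_cl together with the poison sample (x_p, +1). Then the unique minimizer f_poi of the regularized hinge loss L_H(D_poi, ·) over EuclideanSpace ℝ (Fin d) satisfies ⟨f_poi, x_p⟩ ≥ 1. -/
open scoped RealInnerProductSpace BigOperators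

/-- Any minimizer of the poisoned regularized hinge loss classifies the
poison sample with margin at least 1 (zero-projection special case). -/
theorem stmt_12 (d n : ℕ) (hd : 0 < d)
    (u : EuclideanSpace ℝ (Fin d)) (hu : ‖u‖ = 1)
    (C η : ℝ) (hC : 0 < C) (hη : η > 1 / Real.sqrt C)
    (x_p : EuclideanSpace ℝ (Fin d)) (hxp : x_p = η • u)
    (x : Fin n → EuclideanSpace ℝ (Fin d)) (y : Fin n → ℝ)
    (hy : ∀ i, y i = -1 ∨ y i = 1)
    (horth : ∀ i, ⟪x i, u⟫ = 0)
    (Lpoi : EuclideanSpace ℝ (Fin d) → ℝ)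
    (hLpoi : Lpoi = fun f => (1 / 2) * ‖f‖ ^ 2
      + C * ∑ i, max 0 (1 - y i * ⟪f, x i⟫) + C * max 0 (1 - ⟪f, x_p⟫))
    (f_poi : EuclideanSpace ℝ (Fin d))
    (hmin : ∀ f, Lpoi f_poi ≤ Lpoi f) :
    ⟪f_poi, x_p⟫ ≥ 1 := by
  have hη0 : 0 < η := lt_trans (by positivity) hη
  have hCη : 1 < C * η ^ 2 := by
    have h : 1 < η * √C := (div_lt_iff₀ (Real.sqrt_pos.2 hC)).1 hη
    nlinarith [Real.sq_sqrt hC.le]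
  by_contra! hlt
  have hfp : ⟪f_poi, x_p⟫ = η * ⟪f_poi, u⟫ := by rw [hxp, real_inner_smul_right]
  set a := ⟪f_poi, u⟫ with ha
  set t := 1 / η - a with ht
  have hηt : η * t = 1 - η * a := by rw [ht]; field_simp
  have ht0 : 0 < t := by
    refine pos_of_mul_pos_right (a := η) ?_ hη0.le
    linarith
  have hnorm : ‖f_poi + t • u‖ ^ 2 = ‖f_poi‖ ^ 2 + 2 * t * a + t ^ 2 := by
    rw [norm_add_sq_real, real_inner_smul_right, norm_smul, hu, Real.norm_eq_abs, mul_one, sq_abs,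
      ← ha]
    ring
  have hclean : ∀ i, ⟪f_poi + t • u, x i⟫ = ⟪f_poi, x i⟫ := fun i => by
    rw [inner_add_left, real_inner_smul_left, real_inner_comm (x i) u, horth i, mul_zero, add_zero]
  have hpoison : ⟪f_poi + t • u, x_p⟫ = 1 := by
    rw [inner_add_left, hfp, hxp, real_inner_smul_left, real_inner_smul_right,
      real_inner_self_eq_norm_sq, hu]
    linarith
  have hle := hmin (f_poi + t • u)
  simp only [hLpoi, hnorm, hclean, hpoison, sub_self, max_self, mul_zero, add_zero] at hle
  rw [max_eq_right (by linarith), hfp, ← hηt] at hle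
  have hgain : t * (C * η) ≤ t * (a + t / 2) := by linarith
  have hCle : C * η ≤ a + t / 2 := le_of_mul_le_mul_left hgain ht0
  nlinarith
end

section
/- Let d be a positive integer and x_p ∈ EuclideanSpace ℝ (Fin d) with x_p ≠ 0. Let D_cl = ((x_1,y_1),…,(x_n,y_n)) be labeled samples with y_i ∈ {−1,1} and ⟨x_i, x_p⟩ = 0 for every i, let C > 0, and let D_poi be D_cl together with the extra sample (x_p, +1). Then for every f ∈ EuclideanSpace ℝ (Fin d), writing p = (⟨f,x_p⟩/‖x_p‖²)·x_p and r = f − p, the regularized hinge loss decomposes as L_H(D_poi, f) = [(1/2)·‖r‖² + C·Σ_{i=1}^n max(0, 1 − y_i·⟨r,x_i⟩)] + [(1/2)·‖p‖² + C·max(0, 1 − ⟨p,x_p⟩)]. -/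
open scoped RealInnerProductSpace BigOperators

/-- Orthogonal decomposition of the poisoned regularized hinge loss
into a benign part (remainder) and a poison part (projection). -/
theorem stmt_13 (d n : ℕ) (hd : 0 < d)
    (x_p : EuclideanSpace ℝ (Fin d)) (hxp : x_p ≠ 0)
    (x : Fin n → EuclideanSpace ℝ (Fin d)) (y : Fin n → ℝ)
    (hy : ∀ i, y i = -1 ∨ y i = 1)
    (horth : ∀ i, ⟪x i, x_p⟫ = 0)
    (C : ℝ) (hC : 0 < C)
    (f : EuclideanSpace ℝ (Fin d))
    (p r : EuclideanSpace ℝ (Fin d))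
    (hp : p = (⟪f, x_p⟫ / ‖x_p‖ ^ 2) • x_p) (hr : r = f - p) :
    (1 / 2) * ‖f‖ ^ 2 + C * ∑ i, max 0 (1 - y i * ⟪f, x i⟫) + C * max 0 (1 - ⟪f, x_p⟫)
      = ((1 / 2) * ‖r‖ ^ 2 + C * ∑ i, max 0 (1 - y i * ⟪r, x i⟫))
        + ((1 / 2) * ‖p‖ ^ 2 + C * max 0 (1 - ⟪p, x_p⟫)) := by
  have hpx : ⟪p, x_p⟫ = ⟪f, x_p⟫ := by
    have h : ‖x_p‖ ^ 2 ≠ 0 := pow_ne_zero 2 (norm_ne_zero_iff.mpr hxp)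
    rw [hp, real_inner_smul_left, real_inner_self_eq_norm_sq, div_mul_cancel₀ _ h]
  have hrx : ∀ i, ⟪r, x i⟫ = ⟪f, x i⟫ := by
    intro i
    rw [hr, inner_sub_left, hp, real_inner_smul_left, real_inner_comm (x i) x_p, horth i,
      mul_zero, sub_zero]
  have hrp : ⟪r, p⟫ = 0 := by
    have h : ⟪r, x_p⟫ = 0 := by rw [hr, inner_sub_left, hpx, sub_self]
    rw [hp, real_inner_smul_right, h, mul_zero]
  have hnorm : ‖f‖ ^ 2 = ‖r‖ ^ 2 + ‖p‖ ^ 2 := by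
    have hf : f = r + p := by rw [hr, sub_add_cancel]
    rw [hf, norm_add_sq_real, hrp]
    ring
  simp only [hrx, hpx, hnorm]
  ring
end

section
/- Let d be a positive integer and x_p ∈ EuclideanSpace ℝ (Fin d) with x_p ≠ 0. Let D_cl = ((x_1,y_1),…,(x_n,y_n)) be labeled samples with y_i ∈ {−1,1} and ⟨x_i, x_p⟩ = 0 for every i, and let C > 0. Then the unique minimizer f* of the regularized hinge loss L_H(D_cl, ·) over EuclideanSpace ℝ (Fin d) satisfies ⟨f*, x_p⟩ = 0. -/
open scoped RealInnerProductSpace BigOperators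

/-- The unique minimizer of the clean regularized hinge loss is orthogonal
to any direction orthogonal to all the samples. -/
theorem stmt_14 (d n : ℕ) (hd : 0 < d)
    (x_p : EuclideanSpace ℝ (Fin d)) (hxp : x_p ≠ 0)
    (x : Fin n → EuclideanSpace ℝ (Fin d)) (y : Fin n → ℝ)
    (hy : ∀ i, y i = -1 ∨ y i = 1)
    (horth : ∀ i, ⟪x i, x_p⟫ = 0)
    (C : ℝ) (hC : 0 < C)
    (Lcl : EuclideanSpace ℝ (Fin d) → ℝ)
    (hLcl : Lcl = fun f => (1 / 2) * ‖f‖ ^ 2 + C * ∑ i, max 0 (1 - y i * ⟪f, x i⟫))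
    (fstar : EuclideanSpace ℝ (Fin d))
    (hmin : ∀ f, Lcl fstar ≤ Lcl f) :
    ⟪fstar, x_p⟫ = 0 := by
  subst hLcl
  set t : ℝ := ⟪fstar, x_p⟫ / ‖x_p‖ ^ 2 with ht
  have hpos : 0 < ‖x_p‖ ^ 2 := by positivity
  have hinner : ⟪fstar, x_p⟫ = t * ‖x_p‖ ^ 2 := by
    rw [ht, div_mul_cancel₀ _ hpos.ne']
  have hloss : ∀ i, ⟪fstar - t • x_p, x i⟫ = ⟪fstar, x i⟫ := fun i => by
    rw [inner_sub_left, real_inner_smul_left, real_inner_comm, real_inner_comm (x i) x_p,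
      horth i, mul_zero, sub_zero, real_inner_comm]
  have hnorm : ‖fstar - t • x_p‖ ^ 2 = ‖fstar‖ ^ 2 - t ^ 2 * ‖x_p‖ ^ 2 := by
    rw [norm_sub_sq_real, real_inner_smul_right, hinner, norm_smul, mul_pow, Real.norm_eq_abs,
      sq_abs]
    ring
  have hle := hmin (fstar - t • x_p)
  simp only [hloss, hnorm] at hle
  have ht_sq : t ^ 2 ≤ 0 := nonpos_of_mul_nonpos_left (by linarith) hpos
  rw [hinner, pow_eq_zero_iff two_ne_zero |>.mp (le_antisymm ht_sq (sq_nonneg t)), zero_mul]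
end

section
/- Let d be a positive integer and x_p ∈ EuclideanSpace ℝ (Fin d) with x_p ≠ 0. Let D_cl = ((x_1,y_1),…,(x_n,y_n)) be labeled samples with y_i ∈ {−1,1} and ⟨x_i, x_p⟩ = 0 for every i, let C > 0, and let D_poi be D_cl together with the extra sample (x_p, +1). Let f_cl be the unique minimizer of the regularized hinge loss L_H(D_cl, ·) and f_poi the unique minimizer of L_H(D_poi, ·). Then for every x ∈ EuclideanSpace ℝ (Fin d) with ⟨x, x_p⟩ = 0, one has ⟨f_poi, x⟩ = ⟨f_cl, x⟩. -/
open scoped RealInnerProductSpace BigOperators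

/-- Functional equivalence for classification: when all benign samples are
orthogonal to the poison sample, the poisoned classifier agrees with the
clean classifier on every input orthogonal to the poison direction. -/
theorem stmt_15 (d n : ℕ) (hd : 0 < d)
    (x_p : EuclideanSpace ℝ (Fin d)) (hxp : x_p ≠ 0)
    (x : Fin n → EuclideanSpace ℝ (Fin d)) (y : Fin n → ℝ)
    (hy : ∀ i, y i = -1 ∨ y i = 1)
    (horth : ∀ i, ⟪x i, x_p⟫ = 0)
    (C : ℝ) (hC : 0 < C)
    (Lcl Lpoi : EuclideanSpace ℝ (Fin d) → ℝ)
    (hLcl : Lcl = fun f => (1 / 2) * ‖f‖ ^ 2 + C * ∑ i, max 0 (1 - y i * ⟪f, x i⟫))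
    (hLpoi : Lpoi = fun f => (1 / 2) * ‖f‖ ^ 2 + C * ∑ i, max 0 (1 - y i * ⟪f, x i⟫)
      + C * max 0 (1 - ⟪f, x_p⟫))
    (f_cl f_poi : EuclideanSpace ℝ (Fin d))
    (hmincl : ∀ f, Lcl f_cl ≤ Lcl f)
    (hminpoi : ∀ f, Lpoi f_poi ≤ Lpoi f) :
    ∀ x' : EuclideanSpace ℝ (Fin d), ⟪x', x_p⟫ = 0 → ⟪f_poi, x'⟫ = ⟪f_cl, x'⟫ := by
  intro x' hx'
  have hpp : ⟪x_p, x_p⟫ ≠ 0 := inner_self_ne_zero.mpr hxp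
  obtain ⟨c, hc⟩ : ∃ c : ℝ, c * ⟪x_p, x_p⟫ = ⟪f_poi, x_p⟫ - ⟪f_cl, x_p⟫ :=
    ⟨_, div_mul_cancel₀ _ hpp⟩
  -- `e` is the component of `f_poi - f_cl` orthogonal to `x_p`.
  obtain ⟨e, he⟩ : ∃ e, f_poi = f_cl + c • x_p + e := ⟨f_poi - f_cl - c • x_p, by abel⟩
  have hep : ⟪e, x_p⟫ = 0 := by
    rw [he, inner_add_left, inner_add_left, real_inner_smul_left] at hc
    linarith
  have hcl := hmincl (f_cl + (1 / 2 : ℝ) • e)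
  have hpoi := hminpoi (f_poi - (1 / 2 : ℝ) • e)
  simp only [hLcl] at hcl
  simp only [hLpoi] at hpoi
  have hpoison : ⟪f_poi - (1 / 2 : ℝ) • e, x_p⟫ = ⟪f_poi, x_p⟫ := by
    rw [inner_sub_left, real_inner_smul_left, hep, mul_zero, sub_zero]
  rw [hpoison] at hpoi
  have hsum : ∑ i, max 0 (1 - y i * ⟪f_cl + (1 / 2 : ℝ) • e, x i⟫)
      + ∑ i, max 0 (1 - y i * ⟪f_poi - (1 / 2 : ℝ) • e, x i⟫)
      ≤ ∑ i, max 0 (1 - y i * ⟪f_cl, x i⟫) + ∑ i, max 0 (1 - y i * ⟪f_poi, x i⟫) := by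
    rw [← Finset.sum_add_distrib, ← Finset.sum_add_distrib]
    refine Finset.sum_le_sum fun i _ => ?_
    have hpi : ⟪x_p, x i⟫ = 0 := by rw [real_inner_comm, horth i]
    simp only [he, inner_add_left, inner_sub_left, real_inner_smul_left, hpi]
    have h₁ := le_max_left 0 (1 - y i * ⟪f_cl, x i⟫)
    have h₂ := le_max_right 0 (1 - y i * ⟪f_cl, x i⟫)
    have h₃ := le_max_left 0 (1 - y i * (⟪f_cl, x i⟫ + c * 0 + ⟪e, x i⟫))
    have h₄ := le_max_right 0 (1 - y i * (⟪f_cl, x i⟫ + c * 0 + ⟪e, x i⟫))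
    rw [← le_sub_iff_add_le]
    refine max_le ?_ ?_ <;> rw [le_sub_comm] <;> refine max_le ?_ ?_ <;> nlinarith
  have hsumC := mul_le_mul_of_nonneg_left hsum hC.le
  have hpe : ⟪x_p, e⟫ = 0 := by rw [real_inner_comm, hep]
  have hnorm_cl := norm_add_sq_real f_cl ((1 / 2 : ℝ) • e)
  have hnorm_poi := norm_sub_sq_real f_poi ((1 / 2 : ℝ) • e)
  have hinner : ⟪f_poi, e⟫ = ⟪f_cl, e⟫ + ‖e‖ ^ 2 := by
    rw [he, inner_add_left, inner_add_left, real_inner_smul_left, hpe,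
      real_inner_self_eq_norm_sq]
    ring
  have hnorm_half : ‖(1 / 2 : ℝ) • e‖ ^ 2 = ‖e‖ ^ 2 / 4 := by
    rw [norm_smul, mul_pow]
    norm_num
    ring
  rw [real_inner_smul_right, hnorm_half] at hnorm_cl hnorm_poi
  have hzero : e = 0 := by
    rw [← norm_eq_zero, ← sq_eq_zero_iff]
    refine le_antisymm ?_ (sq_nonneg _)
    linarith
  rw [he, hzero, add_zero, inner_add_left, real_inner_smul_left,
    real_inner_comm x' x_p, hx', mul_zero, add_zero]
end

section
/- Let d, n be positive integers, (x_1,y_1),…,(x_n,y_n) labeled samples with x_i ∈ EuclideanSpace ℝ (Fin d) and y_i ∈ {−1,1}, and C > 0. Suppose α ∈ ℝⁿ with 0 ≤ α_i ≤ C for all i maximizes the dual objective W(α) = Σ_{i=1}^n α_i − (1/2)·Σ_{i=1}^n Σ_{j=1}^n α_i·α_j·y_i·y_j·⟨x_i, x_j⟩ over the box [0,C]ⁿ. Then w = Σ_{i=1}^n α_i·y_i·x_i minimizes the regularized hinge loss L_H(D, f) = (1/2)·‖f‖² + C·Σ_{i=1}^n max(0, 1 − y_i·⟨f, x_i⟩)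 over f ∈ EuclideanSpace ℝ (Fin d). -/
open scoped RealInnerProductSpace BigOperators

/-- A quadratic `t * a - t ^ 2 / 2 * b` that is nonpositive on `(0, 1]` has nonpositive slope at
the origin. -/
lemma nonpos_of_forall_mul_sub_sq_mul_nonpos {a b : ℝ} (hb : 0 ≤ b)
    (h : ∀ t : ℝ, 0 < t → t ≤ 1 → t * a - t ^ 2 / 2 * b ≤ 0) : a ≤ 0 := by
  by_contra! ha
  have hab : 0 < a + b := by linarith
  have ht : 0 < a / (a + b) := div_pos ha hab
  have h1 := h (a / (a + b)) ht ((div_le_one hab).2 (by linarith))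
  have h2 : a / (a + b) * (a + b) = a := div_mul_cancel₀ _ hab.ne'
  have h3 : a / (a + b) * (a - a / (a + b) / 2 * b) ≤ 0 := by linarith
  have h4 : a - a / (a + b) / 2 * b ≤ 0 := nonpos_of_mul_nonpos_right h3 ht
  nlinarith [mul_pos ht ha]

section SVMDual

variable {ι E : Type*} [Fintype ι] [NormedAddCommGroup E] [InnerProductSpace ℝ E]

lemma sum_sum_mul_inner_eq_norm_sq (x : ι → E) (y α : ι → ℝ) :
    ∑ i, ∑ j, α i * α j * y i * y j * ⟪x i, x j⟫ = ‖∑ i, (α i * y i) • x i‖ ^ 2 := by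
  rw [← real_inner_self_eq_norm_sq, sum_inner]
  refine Finset.sum_congr rfl fun i _ => ?_
  rw [inner_sum]
  refine Finset.sum_congr rfl fun j _ => ?_
  rw [real_inner_smul_left, real_inner_smul_right]
  ring

lemma inner_sum_mul_smul (f : E) (x : ι → E) (y α : ι → ℝ) :
    ⟪f, ∑ i, (α i * y i) • x i⟫ = ∑ i, α i * (y i * ⟪f, x i⟫) := by
  rw [inner_sum]
  refine Finset.sum_congr rfl fun i _ => ?_
  rw [real_inner_smul_right]
  ring

/-- First-order optimality condition for a maximizer of the SVM dual over a box. -/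
lemma sum_sub_mul_margin_nonpos_of_dual_max (x : ι → E) (y : ι → ℝ) {C : ℝ} {α : ι → ℝ}
    (hα : ∀ i, 0 ≤ α i ∧ α i ≤ C)
    (hmax : ∀ β : ι → ℝ, (∀ i, 0 ≤ β i ∧ β i ≤ C) →
      ∑ i, β i - (1 / 2) * ‖∑ i, (β i * y i) • x i‖ ^ 2
        ≤ ∑ i, α i - (1 / 2) * ‖∑ i, (α i * y i) • x i‖ ^ 2)
    {γ : ι → ℝ} (hγ : ∀ i, 0 ≤ γ i ∧ γ i ≤ C) :
    ∑ i, (γ i - α i) * (1 - y i * ⟪∑ j, (α j * y j) • x j, x i⟫) ≤ 0 := by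
  set w := ∑ i, (α i * y i) • x i with hw
  set v := ∑ i, ((γ i - α i) * y i) • x i with hv
  refine nonpos_of_forall_mul_sub_sq_mul_nonpos (sq_nonneg ‖v‖) fun t ht ht1 => ?_
  have h := hmax (fun i => α i + t * (γ i - α i)) fun i => by
    obtain ⟨h1, h2⟩ := hα i
    obtain ⟨h3, h4⟩ := hγ i
    constructor <;> nlinarith
  have hsum : ∑ i, ((α i + t * (γ i - α i)) * y i) • x i = w + t • v := by
    rw [hw, hv, Finset.smul_sum, ← Finset.sum_add_distrib]
    refine Finset.sum_congr rfl fun i _ => ?_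
    rw [smul_smul, ← add_smul]
    ring_nf
  have hinner : ⟪w, v⟫ = ∑ i, (γ i - α i) * (y i * ⟪w, x i⟫) :=
    inner_sum_mul_smul w x y fun i => γ i - α i
  simp only [hsum, Finset.sum_add_distrib, ← Finset.mul_sum] at h
  rw [norm_add_sq_real, real_inner_smul_right, norm_smul, mul_pow, Real.norm_eq_abs, sq_abs] at h
  simp only [mul_sub, mul_one, Finset.sum_sub_distrib (f := fun i => γ i - α i)]
  rw [← hinner]
  linarith

/-- Weak duality for the soft-margin linear SVM. -/
lemma dual_le_regularized_hinge (x : ι → E) (y : ι → ℝ) {C : ℝ} {α : ι → ℝ}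
    (hα : ∀ i, 0 ≤ α i ∧ α i ≤ C) (f : E) :
    ∑ i, α i - (1 / 2) * ‖∑ i, (α i * y i) • x i‖ ^ 2
      ≤ (1 / 2) * ‖f‖ ^ 2 + C * ∑ i, max 0 (1 - y i * ⟪f, x i⟫) := by
  have h : ∑ i, α i * (1 - y i * ⟪f, x i⟫) ≤ C * ∑ i, max 0 (1 - y i * ⟪f, x i⟫) := by
    rw [Finset.mul_sum]
    refine Finset.sum_le_sum fun i _ => ?_
    exact (mul_le_mul_of_nonneg_left (le_max_right _ _) (hα i).1).trans
      (mul_le_mul_of_nonneg_right (hα i).2 (le_max_left _ _))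
  simp only [mul_sub, mul_one, Finset.sum_sub_distrib] at h
  rw [← inner_sum_mul_smul] at h
  have hsq := sq_nonneg ‖f - ∑ i, (α i * y i) • x i‖
  rw [norm_sub_sq_real] at hsq
  linarith

end SVMDual

/-- Strong duality for the soft-margin linear SVM: any maximizer of the dual
objective over the box `[0, C]ⁿ` yields, via `w = ∑ i, α i • y i • x i`,
a minimizer of the primal regularized hinge loss. -/
theorem stmt_16 (d n : ℕ) (hd : 0 < d) (hn : 0 < n)
    (x : Fin n → EuclideanSpace ℝ (Fin d)) (y : Fin n → ℝ)
    (hy : ∀ i, y i = -1 ∨ y i = 1)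
    (C : ℝ) (hC : 0 < C)
    (W : (Fin n → ℝ) → ℝ)
    (hW : W = fun α => ∑ i, α i
      - (1 / 2) * ∑ i, ∑ j, α i * α j * y i * y j * ⟪x i, x j⟫)
    (α : Fin n → ℝ) (hbox : ∀ i, 0 ≤ α i ∧ α i ≤ C)
    (hmax : ∀ β : Fin n → ℝ, (∀ i, 0 ≤ β i ∧ β i ≤ C) → W β ≤ W α)
    (w : EuclideanSpace ℝ (Fin d)) (hw : w = ∑ i, (α i * y i) • x i) :
    ∀ f : EuclideanSpace ℝ (Fin d),
      (1 / 2) * ‖w‖ ^ 2 + C * ∑ i, max 0 (1 - y i * ⟪w, x i⟫)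
        ≤ (1 / 2) * ‖f‖ ^ 2 + C * ∑ i, max 0 (1 - y i * ⟪f, x i⟫) := by
  intro f
  subst hW hw
  simp only [sum_sum_mul_inner_eq_norm_sq] at hmax
  refine le_trans ?_ (dual_le_regularized_hinge x y hbox f)
  set w := ∑ i, (α i * y i) • x i with hw
  have hopt := sum_sub_mul_margin_nonpos_of_dual_max x y hbox hmax
    (γ := fun i => if 0 ≤ 1 - y i * ⟪w, x i⟫ then C else 0)
    fun i => by split_ifs <;> simp [hC.le]
  rw [← hw] at hopt
  have hγ : ∀ i, (if 0 ≤ 1 - y i * ⟪w, x i⟫ then C else 0) * (1 - y i * ⟪w, x i⟫)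
      = C * max 0 (1 - y i * ⟪w, x i⟫) := fun i => by
    split_ifs with h
    · rw [max_eq_right h]
    · rw [max_eq_left (not_le.1 h).le, zero_mul, mul_zero]
  have hα : ∑ i, α i * (1 - y i * ⟪w, x i⟫) = ∑ i, α i - ‖w‖ ^ 2 := by
    simp only [mul_sub, mul_one, Finset.sum_sub_distrib]
    rw [← inner_sum_mul_smul, ← hw, real_inner_self_eq_norm_sq]
  simp only [sub_mul _ (α _), hγ, Finset.sum_sub_distrib, ← Finset.mul_sum] at hopt
  linarith
end

section
/- Let d be a positive integer, u a unit vector in EuclideanSpace ℝ (Fin d), C > 0, η > 1/√C, and x_p = η·u. Let D_poi consist of labeled samples (x_1,y_1),…,(x_n,y_n) with y_i ∈ {−1,1} and ⟨x_i, u⟩ = 0 for every i, together with the poison sample (x_p, +1). Suppose α (indexed by the n+1 samples of D_poi) with components in [0,C] maximizes the dual objective W(α) = Σ_i α_i − (1/2)·Σ_{i,j} α_i·α_j·y_i·y_j·⟨x_i, x_j⟩ over the box, and let w be the corresponding primal vector w = Σ_i α_i·y_i·x_i (sums over all samples of D_poi, the poison sample having label +1). Then ⟨w, x_p⟩ ≥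 1. -/
open scoped RealInnerProductSpace BigOperators

/-- The quadratic form of the dual objective splits when the last point is orthogonal to all
others. -/
lemma dual_quadratic_form_snoc {E : Type*} [NormedAddCommGroup E] [InnerProductSpace ℝ E] {n : ℕ}
    (x : Fin n → E) (p : E) (y β : Fin n → ℝ) (t : ℝ) (horth : ∀ i, ⟪x i, p⟫ = 0) :
    ∑ i, ∑ j, (Fin.snoc β t : Fin (n + 1) → ℝ) i * (Fin.snoc β t : Fin (n + 1) → ℝ) j
        * (Fin.snoc y 1 : Fin (n + 1) → ℝ) i * (Fin.snoc y 1 : Fin (n + 1) → ℝ) j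
        * ⟪(Fin.snoc x p : Fin (n + 1) → E) i, (Fin.snoc x p : Fin (n + 1) → E) j⟫
      = ∑ i, ∑ j, β i * β j * y i * y j * ⟪x i, x j⟫ + t ^ 2 * ‖p‖ ^ 2 := by
  have horth' : ∀ i, ⟪p, x i⟫ = 0 := fun i => by rw [real_inner_comm]; exact horth i
  simp only [Fin.sum_univ_castSucc, Fin.snoc_castSucc, Fin.snoc_last, horth, horth',
    real_inner_self_eq_norm_sq, mul_zero, add_zero, Finset.sum_const_zero, zero_add]
  ring

/-- A learner using dual optimization on the poisoned data is backdoored: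
the primal vector obtained from any dual maximizer assigns the poison sample
a margin of at least 1 (zero-projection special case). -/
theorem stmt_17 (d n : ℕ) (hd : 0 < d)
    (u : EuclideanSpace ℝ (Fin d)) (hu : ‖u‖ = 1)
    (C η : ℝ) (hC : 0 < C) (hη : η > 1 / Real.sqrt C)
    (x_p : EuclideanSpace ℝ (Fin d)) (hxp : x_p = η • u)
    (x : Fin n → EuclideanSpace ℝ (Fin d)) (y : Fin n → ℝ)
    (hy : ∀ i, y i = -1 ∨ y i = 1)
    (horth : ∀ i, ⟪x i, u⟫ = 0)
    (xp' : Fin (n + 1) → EuclideanSpace ℝ (Fin d)) (yp' : Fin (n + 1) → ℝ)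
    (hxp' : xp' = Fin.snoc x x_p) (hyp' : yp' = Fin.snoc y 1)
    (W : (Fin (n + 1) → ℝ) → ℝ)
    (hW : W = fun α => ∑ i, α i
      - (1 / 2) * ∑ i, ∑ j, α i * α j * yp' i * yp' j * ⟪xp' i, xp' j⟫)
    (α : Fin (n + 1) → ℝ) (hbox : ∀ i, 0 ≤ α i ∧ α i ≤ C)
    (hmax : ∀ β : Fin (n + 1) → ℝ, (∀ i, 0 ≤ β i ∧ β i ≤ C) → W β ≤ W α)
    (w : EuclideanSpace ℝ (Fin d)) (hw : w = ∑ i, (α i * yp' i) • xp' i) :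
    ⟪w, x_p⟫ ≥ 1 := by
  have hη0 : 0 < η := lt_trans (by positivity) hη
  have hη2 : 1 / η ^ 2 < C := by
    rw [gt_iff_lt, div_lt_iff₀ (Real.sqrt_pos.2 hC)] at hη
    rw [div_lt_iff₀ (by positivity)]
    have h := Real.sq_sqrt hC.le
    calc (1 : ℝ) < (η * Real.sqrt C) ^ 2 := by nlinarith
      _ = C * η ^ 2 := by rw [mul_pow, h]; ring
  have hp : ∀ i, ⟪x i, x_p⟫ = 0 := fun i => by rw [hxp, inner_smul_right, horth, mul_zero]
  have hnorm : ‖x_p‖ ^ 2 = η ^ 2 := by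
    rw [hxp, norm_smul, hu, mul_one, Real.norm_eq_abs, sq_abs]
  obtain ⟨a, t, rfl⟩ : ∃ (a : Fin n → ℝ) (t : ℝ), α = Fin.snoc a t :=
    ⟨Fin.init α, α (Fin.last n), (Fin.snoc_init_self α).symm⟩
  have hWs : ∀ s : ℝ, W (Fin.snoc a s) = ∑ i, a i + s
      - (1 / 2) * (∑ i, ∑ j, a i * a j * y i * y j * ⟪x i, x j⟫ + s ^ 2 * η ^ 2) := by
    intro s
    subst hW hxp' hyp'
    simp only [dual_quadratic_form_snoc x x_p y a s hp, hnorm]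
    simp [Fin.sum_univ_castSucc]
  have hle := hmax (Fin.snoc a (1 / η ^ 2)) (by
    intro i
    refine Fin.lastCases ?_ (fun j => ?_) i
    · simpa only [Fin.snoc_last] using
        (⟨by positivity, hη2.le⟩ : 0 ≤ 1 / η ^ 2 ∧ 1 / η ^ 2 ≤ C)
    · simpa only [Fin.snoc_castSucc] using hbox j.castSucc)
  rw [hWs, hWs] at hle
  have hwp : ⟪w, x_p⟫ = t * η ^ 2 := by
    subst hw hxp' hyp'
    simp [Fin.sum_univ_castSucc, inner_add_left, sum_inner, inner_smul_left, hp, hnorm]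
  have hs : 1 / η ^ 2 * η ^ 2 = 1 := by field_simp
  have hsq : (t * η ^ 2 - 1) ^ 2 ≤ 0 := by
    generalize 1 / η ^ 2 = s at hle hs
    have hpos : 0 ≤ η ^ 2 := sq_nonneg η
    have h : s - t - (1 / 2) * (s ^ 2 - t ^ 2) * η ^ 2 ≤ 0 := by linarith
    have h2 : (t * η ^ 2 - 1) ^ 2
        = 2 * η ^ 2 * (s - t - (1 / 2) * (s ^ 2 - t ^ 2) * η ^ 2) := by
      linear_combination (s * η ^ 2 - 1) * hs
    rw [h2]
    exact mul_nonpos_of_nonneg_of_nonpos (by positivity) h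
  have := pow_eq_zero_iff (two_ne_zero) |>.1 (le_antisymm hsq (sq_nonneg _))
  linarith
end

section
/- Let X be a measurable space, x_p ∈ X a point with measurable singleton {x_p}, μ_cl a probability measure on X, n ≥ 2 an integer, and μ_poi = (1 − 1/n)·μ_cl + (1/n)·δ_{x_p}, where δ_{x_p} is the Dirac measure at x_p. Let 0 < α ≤ 1, C' > 0, and let l : ℝ × ℝ → ℝ be nonnegative and satisfy l(a,b) ≤ l(a,c) + C'·|c − b|^α for all a,b,c ∈ ℝ. Let f̂, f*_poi, f*_cl : X → ℝ be measurable with x ↦ l(f̂(x), f*_poi(x)) integrable with respect to μ_poi, and suppose f*_poi(x) = f*_cl(x) for all x ≠ x_p and |f*_poi(x_p) − f*_cl(x_p)| ≤ 1/n. Then ∫ l(f̂(x), f*_cl(x)) dμ_cl(x) ≤ (1 − 1/n)⁻¹ · ∫ l(f̂(x), f*_poi(x)) dμ_poi(x) + C'·(μ_cl({x_p})/n)^α. -/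
open MeasureTheory

/-- Classification statistical-risk corollary: the risk on benign data is
bounded by the risk on poisoned data plus a term vanishing in `1/n`. -/
theorem stmt_19 {X : Type*} [MeasurableSpace X]
    (x_p : X) (hxp : MeasurableSet ({x_p} : Set X))
    (μcl : Measure X) [IsProbabilityMeasure μcl]
    (n : ℕ) (hn : 2 ≤ n)
    (μpoi : Measure X)
    (hμpoi : μpoi = ENNReal.ofReal (1 - 1 / (n : ℝ)) • μcl
      + ENNReal.ofReal (1 / (n : ℝ)) • Measure.dirac x_p)
    (α C' : ℝ) (hα0 : 0 < α) (hα1 : α ≤ 1) (hC' : 0 < C')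
    (l : ℝ → ℝ → ℝ) (hl0 : ∀ a b, 0 ≤ l a b)
    (hlip : ∀ a b c, l a b ≤ l a c + C' * |c - b| ^ α)
    (fhat fpoi fcl : X → ℝ)
    (hfhat : Measurable fhat) (hfpoi : Measurable fpoi) (hfcl : Measurable fcl)
    (hint : Integrable (fun x => l (fhat x) (fpoi x)) μpoi)
    (heq : ∀ x, x ≠ x_p → fpoi x = fcl x)
    (hdiff : |fpoi x_p - fcl x_p| ≤ 1 / (n : ℝ)) :
    ∫ x, l (fhat x) (fcl x) ∂μcl
      ≤ (1 - 1 / (n : ℝ))⁻¹ * ∫ x, l (fhat x) (fpoi x) ∂μpoi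
        + C' * ((μcl {x_p}).toReal / (n : ℝ)) ^ α := by
  have hn2 : (2 : ℝ) ≤ n := by exact_mod_cast hn
  have hnpos : (0 : ℝ) < n := by linarith
  have hinv : 1 / (n : ℝ) ≤ 1 / 2 := one_div_le_one_div_of_le (by norm_num) hn2
  have hc : 0 < 1 - 1 / (n : ℝ) := by linarith
  have hc_ne : ENNReal.ofReal (1 - 1 / (n : ℝ)) ≠ 0 := (ENNReal.ofReal_pos.2 hc).ne'
  rw [hμpoi] at hint ⊢
  have hint_cl : Integrable (fun x => l (fhat x) (fpoi x)) μcl :=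
    (integrable_smul_measure hc_ne ENNReal.ofReal_ne_top).1 hint.left_of_add_measure
  have hrisk : ∫ x, l (fhat x) (fpoi x) ∂μcl ≤ (1 - 1 / (n : ℝ))⁻¹ *
      ∫ x, l (fhat x) (fpoi x) ∂(ENNReal.ofReal (1 - 1 / (n : ℝ)) • μcl
        + ENNReal.ofReal (1 / (n : ℝ)) • Measure.dirac x_p) := by
    rw [integral_add_measure hint.left_of_add_measure hint.right_of_add_measure,
      integral_smul_measure, ENNReal.toReal_ofReal hc.le, smul_eq_mul, mul_add,
      inv_mul_cancel_left₀ hc.ne']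
    exact le_add_of_nonneg_right
      (mul_nonneg (inv_nonneg.2 hc.le) (integral_nonneg fun x => hl0 _ _))
  set K : ℝ := C' * (1 / (n : ℝ)) ^ α with hK
  have hind : Integrable (({x_p} : Set X).indicator fun _ => K) μcl :=
    (integrable_const K).indicator hxp
  have hpoint : ∀ x, l (fhat x) (fcl x) ≤
      l (fhat x) (fpoi x) + ({x_p} : Set X).indicator (fun _ => K) x := by
    intro x
    by_cases hx : x = x_p
    · subst hx
      rw [Set.indicator_of_mem (Set.mem_singleton x)]
      refine (hlip _ _ (fpoi x)).trans ?_
      rw [hK]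
      gcongr
    · rw [Set.indicator_of_notMem (by simpa using hx), add_zero, heq x hx]
  have hmono : ∫ x, l (fhat x) (fcl x) ∂μcl ≤
      ∫ x, l (fhat x) (fpoi x) ∂μcl + μcl.real {x_p} * K := by
    refine (integral_mono_of_nonneg (ae_of_all _ fun x => hl0 _ _) (hint_cl.add hind)
      (ae_of_all _ hpoint)).trans_eq ?_
    simp only [Pi.add_apply]
    rw [integral_add hint_cl hind, integral_indicator_const K hxp, smul_eq_mul]
  have hmass : μcl.real {x_p} * K ≤ C' * ((μcl {x_p}).toReal / (n : ℝ)) ^ α := by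
    have hp : μcl.real {x_p} ≤ μcl.real {x_p} ^ α :=
      Real.self_le_rpow_of_le_one measureReal_nonneg measureReal_le_one hα1
    calc μcl.real {x_p} * K = C' * (μcl.real {x_p} * (1 / (n : ℝ)) ^ α) := by rw [hK]; ring
      _ ≤ C' * (μcl.real {x_p} ^ α * (1 / (n : ℝ)) ^ α) := by gcongr
      _ = C' * ((μcl {x_p}).toReal / (n : ℝ)) ^ α := by
        rw [← Real.mul_rpow measureReal_nonneg (by positivity), mul_one_div, measureReal_def]
  linarith
end
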